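/- arXiv:2001.04004 — 2 statements merged into one kernel-verified Lean document; each statement's English description precedes it below -/
import Mathlib

section
/- Let L = M(r_{a2}), or L = M(s_i) for some 1 ≤ i ≤ a1−1. Let N be a thin representation of (Q,I) whose support quiver is connected (i.e. N is indecomposable). If there exists a nonzero morphism L → N, then N_{r_0} ≠ 0. -/
inductive V (a1 a2 : ℕ) : Type where
  | r : Fin (a2 + 1) → V a1 a2
  | s : Fin (a1 - 1) → V a1 a2
  | t : Fin (a1 - 1) → V a1 a2

def Arrow (a1 a2 : ℕ) : V a1 a2 → V a1 a2 → Prop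
  | .r i, .r j => ((i : ℕ) + 1 = (j : ℕ)) ∨ ((i : ℕ) = a2 ∧ (j : ℕ) = 0)
  | .s i, .s j => (i : ℕ) + 1 = (j : ℕ)
  | .s i, .r j => (i : ℕ) = a1 - 2 ∧ (j : ℕ) = a2
  | .r i, .t j => (i : ℕ) = 0 ∧ (j : ℕ) = 0
  | .t i, .t j => (i : ℕ) + 1 = (j : ℕ)
  | _, _ => False

structure Repn (k : Type) [Field k] (a1 a2 : ℕ) : Type 1 where
  carrier : V a1 a2 → Type
  [acg : ∀ x, AddCommGroup (carrier x)]
  [mod : ∀ x, Module k (carrier x)]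
  fd : ∀ x, FiniteDimensional k (carrier x)
  map : ∀ (x y : V a1 a2), Arrow a1 a2 x y → (carrier x →ₗ[k] carrier y)

attribute [instance] Repn.acg Repn.mod

def HomSpace {k : Type} [Field k] {a1 a2 : ℕ} (ρ σ : Repn k a1 a2) :
    Submodule k (∀ x : V a1 a2, ρ.carrier x →ₗ[k] σ.carrier x) where
  carrier := {f | ∀ (x y : V a1 a2) (h : Arrow a1 a2 x y),
      (σ.map x y h).comp (f x) = (f y).comp (ρ.map x y h)}
  add_mem' := by
    intro f g hf hg
    intro x y h
    simp only [Pi.add_apply, LinearMap.comp_add, LinearMap.add_comp]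
    rw [hf x y h, hg x y h]
  zero_mem' := by
    intro x y h
    simp
  smul_mem' := by
    intro c f hf
    intro x y h
    simp only [Pi.smul_apply, LinearMap.comp_smul, LinearMap.smul_comp]
    rw [hf x y h]

def IsSubrep {k : Type} [Field k] {a1 a2 : ℕ} (ρ : Repn k a1 a2)
    (N : ∀ x, Submodule k (ρ.carrier x)) : Prop :=
  ∀ (x y : V a1 a2) (h : Arrow a1 a2 x y), ∀ v ∈ N x, ρ.map x y h v ∈ N y

open Classical in
noncomputable def sp (k : Type) [Field k] {a1 a2 : ℕ} (S : Set (V a1 a2)) (x : V a1 a2) :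
    Submodule k k :=
  if x ∈ S then ⊤ else ⊥

open Classical in
noncomputable def thinMap (k : Type) [Field k] {a1 a2 : ℕ} (S T : Set (V a1 a2))
    (x y : V a1 a2) : (sp k S x) →ₗ[k] (sp k T y) where
  toFun v := if h : y ∈ T then ⟨(v : k), by simp [sp, h]⟩ else 0
  map_add' u v := by
    by_cases h : y ∈ T
    · simp only [dif_pos h]
      exact Subtype.ext (by simp)
    · simp [dif_neg h]
  map_smul' c v := by
    by_cases h : y ∈ T
    · simp only [dif_pos h]
      exact Subtype.ext (by simp)
    · simp [dif_neg h]

noncomputable def thinRep (k : Type) [Field k] {a1 a2 : ℕ} (S : Set (V a1 a2)) :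
    Repn k a1 a2 where
  carrier x := ↥(sp k S x)
  acg := fun _ => inferInstance
  mod := fun _ => inferInstance
  fd := fun _ => inferInstance
  map x y _ := thinMap k S S x y

def suppR (a1 a2 : ℕ) (i : ℕ) : Set (V a1 a2) :=
  {x | match x with
      | .r j => (j : ℕ) ≠ i
      | .s _ => i ≠ a2
      | .t _ => i ≠ 0}

def suppS (a1 a2 : ℕ) (i : ℕ) : Set (V a1 a2) :=
  {x | match x with
      | .r j => (j : ℕ) < a2
      | .s _ => False
      | .t j => (j : ℕ) + 1 < i}

def suppT (a1 a2 : ℕ) (i : ℕ) : Set (V a1 a2) :=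
  {x | match x with
      | .r j => 1 ≤ (j : ℕ)
      | .s j => i ≤ (j : ℕ)
      | .t _ => False}

noncomputable def Mr (k : Type) [Field k] (a1 a2 : ℕ) (i : ℕ) : Repn k a1 a2 :=
  thinRep k (suppR a1 a2 i)

noncomputable def Ms (k : Type) [Field k] (a1 a2 : ℕ) (i : ℕ) : Repn k a1 a2 :=
  thinRep k (suppS a1 a2 i)

noncomputable def Mt (k : Type) [Field k] (a1 a2 : ℕ) (i : ℕ) : Repn k a1 a2 :=
  thinRep k (suppT a1 a2 i)

noncomputable def Mv (k : Type) [Field k] (a1 a2 : ℕ) : V a1 a2 → Repn k a1 a2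
  | .r j => Mr k a1 a2 (j : ℕ)
  | .s j => Ms k a1 a2 ((j : ℕ) + 1)
  | .t j => Mt k a1 a2 ((j : ℕ) + 1)

/-- The relations of the Jacobian ideal: the composition of the structure maps along each path
of length `a2` contained in the oriented cycle `r_0 → r_1 → ⋯ → r_{a2} → r_0` is zero.
This is expressed by: for each `c`, any chain of vectors `v j` at the cycle vertices that is
propagated by the structure maps along every cycle arrow except the one from `r_c`
must satisfy `v c = 0` (the value at the endpoint of the length-`a2` path starting at
`r_{c+1}`). -/
def SatisfiesRel {k : Type} [Field k] {a1 a2 : ℕ} (ρ : Repn k a1 a2) : Prop :=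
  ∀ (c : Fin (a2 + 1)) (v : ∀ j : Fin (a2 + 1), ρ.carrier (V.r j)),
    (∀ (j : Fin (a2 + 1)) (h : Arrow a1 a2 (V.r j) (V.r (j + 1))), j ≠ c →
      ρ.map (V.r j) (V.r (j + 1)) h (v j) = v (j + 1)) →
    v c = 0

/-- A representation is thin if all its spaces have dimension at most one. -/
def IsThin {k : Type} [Field k] {a1 a2 : ℕ} (ρ : Repn k a1 a2) : Prop :=
  ∀ x : V a1 a2, Module.finrank k (ρ.carrier x) ≤ 1

/-- The support quiver of `ρ` is connected: any two vertices carrying a nonzero vector are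
joined by a walk using only arrows whose structure map is nonzero. -/
def SuppConnected {k : Type} [Field k] {a1 a2 : ℕ} (ρ : Repn k a1 a2) : Prop :=
  ∀ x y : V a1 a2, (∃ v : ρ.carrier x, v ≠ 0) → (∃ v : ρ.carrier y, v ≠ 0) →
    Relation.ReflTransGen
      (fun a b => (∃ h : Arrow a1 a2 a b, ρ.map a b h ≠ 0) ∨
                  (∃ h : Arrow a1 a2 b a, ρ.map b a h ≠ 0)) x y

theorem aux_zero {k : Type} [Field k] {a1 a2 : ℕ} (S : Set (V a1 a2)) (N : Repn k a1 a2)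
    (f : ∀ x : V a1 a2, (thinRep k S).carrier x →ₗ[k] N.carrier x) (y : V a1 a2) (hy : y ∉ S) :
    f y = 0 := by
  ext v
  have hv : v = 0 := by
    obtain ⟨v, hv⟩ := v
    apply Subtype.ext
    have hv2 : v = 0 := by simpa [sp, hy] using hv
    exact hv2
  rw [hv]; simp

theorem aux_step {k : Type} [Field k] {a1 a2 : ℕ} (S : Set (V a1 a2)) (N : Repn k a1 a2)
    (f : ∀ x : V a1 a2, (thinRep k S).carrier x →ₗ[k] N.carrier x)
    (hf : f ∈ HomSpace (thinRep k S) N) (x y : V a1 a2) (h : Arrow a1 a2 x y)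
    (hx : x ∈ S) (h0 : f x = 0) : f y = 0 := by
  by_cases hy : y ∈ S
  · apply LinearMap.ext
    intro v
    have e := hf x y h
    rw [h0, LinearMap.comp_zero] at e
    have hw : (v : sp k S y).1 ∈ sp k S x := by simp [sp, hx]
    have e2 := LinearMap.congr_fun e (⟨(v : sp k S y).1, hw⟩ : sp k S x)
    have e3 : (thinRep k S).map x y h (⟨(v : sp k S y).1, hw⟩ : sp k S x) = v := by
      change thinMap k S S x y (⟨(v : sp k S y).1, hw⟩ : sp k S x) = v
      simp only [thinMap, LinearMap.coe_mk, AddHom.coe_mk, dif_pos hy]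
      rfl
    have e4 : f y v = 0 := (congrArg (f y) e3).symm.trans e2.symm
    exact e4
  · exact aux_zero S N f y hy

theorem aux_main {k : Type} [Field k] {a1 a2 : ℕ} (ha2 : 0 < a2) (S : Set (V a1 a2))
    (N : Repn k a1 a2)
    (hr : ∀ j : Fin (a2 + 1), V.r j ∈ S ↔ (j : ℕ) < a2)
    (hs : ∀ j, V.s j ∉ S)
    (ht : ∀ i j : Fin (a1 - 1), (i : ℕ) + 1 = j → V.t j ∈ S → V.t i ∈ S)
    (f : ∀ x : V a1 a2, (thinRep k S).carrier x →ₗ[k] N.carrier x)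
    (hf : f ∈ HomSpace (thinRep k S) N) (h0 : f (V.r 0) = 0) : f = 0 := by
  have hR : ∀ n (hn : n < a2 + 1), f (V.r ⟨n, hn⟩) = 0 := by
    intro n
    induction n with
    | zero => intro hn; exact h0
    | succ n ih =>
      intro hn
      exact aux_step S N f hf (V.r ⟨n, by omega⟩) _ (Or.inl rfl)
        ((hr _).2 (by simp; omega)) (ih _)
  have hT : ∀ n (hn : n < a1 - 1), f (V.t ⟨n, hn⟩) = 0 := by
    intro n
    induction n with
    | zero =>
      intro hn
      exact aux_step S N f hf (V.r 0) _ ⟨rfl, rfl⟩ ((hr _).2 (by simpa using ha2)) h0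
    | succ n ih =>
      intro hn
      by_cases hy : V.t ⟨n + 1, hn⟩ ∈ S
      · exact aux_step S N f hf (V.t ⟨n, by omega⟩) _ rfl (ht _ _ rfl hy) (ih _)
      · exact aux_zero S N f _ hy
  funext x
  cases x with
  | r j => exact hR j.1 j.2
  | s j => exact aux_zero S N f _ (hs j)
  | t j => exact hT j.1 j.2

/-- Let `L = M(r_{a2})` or `L = M(s_i)` for some `1 ≤ i ≤ a1 - 1`, and let `N` be
an indecomposable thin representation of `(Q, I)`. If there is a nonzero morphism `L → N`,
then `N_{r_0} ≠ 0`. -/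
theorem statement7 (k : Type) [Field k] (a1 a2 : ℕ) (ha1 : 0 < a1) (ha2 : 0 < a2)
    (L : Repn k a1 a2)
    (hL : L = Mr k a1 a2 a2 ∨ ∃ i : ℕ, 1 ≤ i ∧ i ≤ a1 - 1 ∧ L = Ms k a1 a2 i)
    (N : Repn k a1 a2) (hrel : SatisfiesRel N) (hthin : IsThin N) (hconn : SuppConnected N)
    (hhom : ∃ f ∈ HomSpace L N, f ≠ 0) :
    ∃ v : N.carrier (V.r 0), v ≠ 0 := by
  by_contra hcon
  push Not at hcon
  obtain ⟨f, hf, hne⟩ := hhom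
  have h0 : f (V.r 0) = 0 := by
    ext v
    exact hcon _
  apply hne
  rcases hL with rfl | ⟨i, hi1, hi2, rfl⟩
  · refine aux_main ha2 (suppR a1 a2 a2) N ?_ ?_ ?_ f hf h0
    · intro j
      change (j : ℕ) ≠ a2 ↔ _
      have := j.2
      omega
    · intro j h
      exact h rfl
    · intro i j _ h
      exact h
  · refine aux_main ha2 (suppS a1 a2 i) N ?_ ?_ ?_ f hf h0
    · intro j
      exact Iff.rfl
    · intro j h
      exact h
    · intro p q hpq h
      change (q : ℕ) + 1 < i at h
      change (p : ℕ) + 1 < i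
      omega
end

section
/- Let L = M(t_i) for some 1 ≤ i ≤ a1−1, and let N be a thin representation of (Q,I) whose support quiver is connected (i.e. N is indecomposable). If there exists a nonzero morphism L → N, then N_{r_1} ≠ 0, or there exists j with i+1 ≤ j ≤ a1−1 such that N_{s_j} ≠ 0 and the structure map of N on every arrow with source s_j is zero (i.e. the simple S(s_j) is a direct summand of the socle of N). -/
theorem thinMap_surj (k : Type) [Field k] {a1 a2 : ℕ} (S : Set (V a1 a2)) (x y : V a1 a2)
    (hx : x ∈ S) : Function.Surjective (thinMap k S S x y) := by
  intro w
  refine ⟨⟨(w : k), by simp [sp, hx]⟩, ?_⟩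
  by_cases hy : y ∈ S
  · simp [thinMap, hy]
  · have h2 := w.2
    simp only [sp, hy, if_false, Submodule.mem_bot] at h2
    apply Subtype.ext
    simp [thinMap, hy, h2]

theorem thinRep_zero (k : Type) [Field k] {a1 a2 : ℕ} (S : Set (V a1 a2)) (x : V a1 a2)
    (hx : x ∉ S) (w : (thinRep k S).carrier x) : w = 0 := by
  have h2 := Subtype.property (p := fun z => z ∈ sp k S x) w
  simp only [sp, hx, if_false, Submodule.mem_bot] at h2
  exact Subtype.ext h2

/-- Let `L = M(t_i)` for some `1 ≤ i ≤ a1 - 1`, and let `N` be an indecomposable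
thin representation of `(Q, I)`. If there is a nonzero morphism `L → N`, then `N_{r_1} ≠ 0`
or there is `j` with `i + 1 ≤ j ≤ a1 - 1` such that `N_{s_j} ≠ 0` and the structure map of
`N` on every arrow with source `s_j` is zero (i.e. `S(s_j)` is a summand of the socle of
`N`). Here the vertex `V.s j` with `j : Fin (a1 - 1)` denotes `s_{j+1}`. -/
theorem statement8 (k : Type) [Field k] (a1 a2 : ℕ) (ha1 : 0 < a1) (ha2 : 0 < a2)
    (i : ℕ) (hi1 : 1 ≤ i) (hi2 : i ≤ a1 - 1)
    (N : Repn k a1 a2) (hrel : SatisfiesRel N) (hthin : IsThin N) (hconn : SuppConnected N)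
    (hhom : ∃ f ∈ HomSpace (Mt k a1 a2 i) N, f ≠ 0) :
    (∃ v : N.carrier (V.r ⟨1, by omega⟩), v ≠ 0) ∨
      ∃ j : Fin (a1 - 1), i ≤ (j : ℕ) ∧
        (∃ v : N.carrier (V.s j), v ≠ 0) ∧
        (∀ (y : V a1 a2) (h : Arrow a1 a2 (V.s j) y), N.map (V.s j) y h = 0) := by
  obtain ⟨f, hf, hne⟩ := hhom
  have hcomm : ∀ (x y : V a1 a2) (h : Arrow a1 a2 x y),
      (N.map x y h).comp (f x) = (f y).comp ((Mt k a1 a2 i).map x y h) := hf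
  by_contra hcon
  push Not at hcon
  obtain ⟨h1, h2⟩ := hcon
  have hout : ∀ x, x ∉ suppT a1 a2 i → f x = 0 := by
    intro x hx
    ext w
    have hw : w = 0 := thinRep_zero k (suppT a1 a2 i) x hx w
    rw [hw]
    simp
  have hr : ∀ (m : ℕ) (hm : m + 1 < a2 + 1), f (V.r ⟨m + 1, hm⟩) = 0 := by
    intro m
    induction m with
    | zero =>
      intro hm
      ext w
      exact h1 _
    | succ m ih =>
      intro hm
      have h := hcomm (V.r ⟨m + 1, by omega⟩) (V.r ⟨m + 1 + 1, hm⟩) (Or.inl rfl)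
      rw [ih (by omega), LinearMap.comp_zero] at h
      ext w
      obtain ⟨u, rfl⟩ := thinMap_surj k (suppT a1 a2 i) (V.r ⟨m + 1, by omega⟩)
        (V.r ⟨m + 1 + 1, hm⟩) (by simp [suppT]) w
      exact (LinearMap.congr_fun h u).symm
  have hr' : ∀ j, f (V.r j) = 0 := by
    rintro ⟨j, hj⟩
    cases j with
    | zero => exact hout _ (by simp [suppT])
    | succ m => exact hr m hj
  have hs : ∃ j, f (V.s j) ≠ 0 := by
    by_contra hc
    push Not at hc
    apply hne
    funext x
    cases x with
    | r j => exact hr' j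
    | s j => exact hc j
    | t j => exact hout _ (by simp [suppT])
  obtain ⟨j, hj, hmax⟩ := Set.exists_max_image {j | f (V.s j) ≠ 0} id (Set.toFinite _) hs
  have hij : i ≤ (j : ℕ) := by
    by_contra hc
    exact hj (hout _ hc)
  obtain ⟨u, hu⟩ : ∃ u, f (V.s j) u ≠ 0 := by
    by_contra hc
    push Not at hc
    exact hj (LinearMap.ext hc)
  obtain ⟨y, h, hy⟩ := h2 j hij ⟨_, hu⟩
  have hfy : f y = 0 := by
    cases y with
    | r j => exact hr' j
    | t l => exact hout _ (by simp [suppT])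
    | s l =>
      by_contra hc
      have h3 : l ≤ j := hmax l hc
      have h4 : (j : ℕ) + 1 = l := h
      have h5 : (l : ℕ) ≤ j := h3
      omega
  apply hy
  have h6 := hcomm _ _ h
  rw [hfy, LinearMap.zero_comp] at h6
  have := N.fd (V.s j)
  ext w
  have h8 : Module.finrank k (N.carrier (V.s j)) = 1 := by
    have : Nontrivial (N.carrier (V.s j)) := ⟨_, _, hu⟩
    have := Module.finrank_pos (R := k) (M := N.carrier (V.s j))
    have := hthin (V.s j)
    omega
  obtain ⟨c, rfl⟩ := (finrank_eq_one_iff_of_nonzero' _ hu).1 h8 w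
  rw [map_smul]
  have h7 : N.map _ _ h (f (V.s j) u) = 0 := LinearMap.congr_fun h6 u
  rw [h7]
  simp
end
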